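/- Let a, b ≥ 6 be real numbers and let F_{a,b} denote the cumulative distribution function of the Beta(a,b) distribution. For any constant C with 0 < C ≤ 1/2, setting z = a/(a+b) + C·√( a·b / ( (a+b)²·(a+b+1) ) ) + C/(a+b), one has 1 − F_{a,b}(z) ≥ 0.15. -/

import Mathlib

noncomputable section

/-- The cumulative distribution function of the `Beta(a,b)` distribution (for arguments
`z ∈ [0,1]`): the normalized incomplete beta integral. -/
def betaCDF (a b z : ℝ) : ℝ :=
  (∫ x in (0 : ℝ)..z, x ^ (a - 1) * (1 - x) ^ (b - 1)) /
    (∫ x in (0 : ℝ)..1, x ^ (a - 1) * (1 - x) ^ (b - 1))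

open Real Filter Topology

/-- The remainder in Stirling's approximation of `log Γ`, including the constant term. -/
def stirlingRemainder (x : ℝ) : ℝ :=
  log (Gamma x) - (x - 1 / 2) * log x + x

lemma stirlingRemainder_sub_succ {x : ℝ} (hx : 0 < x) :
    stirlingRemainder x - stirlingRemainder (x + 1) = (x + 1 / 2) * log (1 + 1 / x) - 1 := by
  have h1 : log (1 + 1 / x) = log (x + 1) - log x := by
    rw [← log_div (by positivity) hx.ne']
    congr 1
    field_simp
  rw [stirlingRemainder, stirlingRemainder, Gamma_add_one hx.ne',
    log_mul hx.ne' (Gamma_pos_of_pos hx).ne', h1]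
  ring

lemma stirlingRemainder_succ_le {x : ℝ} (hx : 0 < x) :
    stirlingRemainder (x + 1) ≤ stirlingRemainder x := by
  have h := le_log_one_add_of_nonneg (x := 1 / x) (by positivity)
  have h1 : 2 * (1 / x) / (1 / x + 2) = 1 / (x + 1 / 2) := by
    field_simp
    ring
  rw [h1, div_le_iff₀ (by positivity)] at h
  linarith [stirlingRemainder_sub_succ hx]

lemma mul_log_one_add_inv_sub_one_le {x : ℝ} (hx : 0 < x) :
    (x + 1 / 2) * log (1 + 1 / x) - 1 ≤ 1 / (12 * x) - 1 / (12 * (x + 1)) := by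
  have hs := hasSum_log_one_add_inv hx
  set t : ℝ := 1 / (2 * x + 1) with ht
  have ht0 : 0 < t := by positivity
  have ht1 : t < 1 := by
    rw [ht, div_lt_one (by positivity)]
    linarith
  have hg : HasSum (fun k : ℕ => 2 * t / 3 * (t ^ 2) ^ k + if k = 0 then 4 * t / 3 else 0)
      (2 * t / 3 * (1 - t ^ 2)⁻¹ + 4 * t / 3) :=
    ((hasSum_geometric_of_lt_one (by positivity) (by nlinarith)).mul_left _).add
      (hasSum_ite_eq 0 _)
  have hle := hasSum_le (fun k => ?_) hs hg
  · have h1 : (x + 1 / 2) * (2 * t / 3 * (1 - t ^ 2)⁻¹ + 4 * t / 3) - 1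
        = 1 / (12 * x) - 1 / (12 * (x + 1)) := by
      have h2 : 1 - t ^ 2 = 4 * x * (x + 1) / (2 * x + 1) ^ 2 := by
        rw [ht]
        field_simp
        ring
      rw [h2, ht]
      field_simp
      ring
    rw [← h1, one_div x]
    gcongr
  · have hp : t ^ (2 * k + 1) = t * (t ^ 2) ^ k := by
      rw [pow_succ, pow_mul]
      ring
    rw [hp]
    rcases Nat.eq_zero_or_pos k with rfl | hk
    · simp
      linarith
    · have hk' : (1 : ℝ) ≤ k := by exact_mod_cast hk
      have h3 : (1 : ℝ) / (2 * k + 1) ≤ 1 / 3 := by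
        apply one_div_le_one_div_of_le <;> linarith
      have hq : 0 < t * (t ^ 2) ^ k := by positivity
      rw [if_neg hk.ne']
      nlinarith

lemma stirlingRemainder_sub_inv_le_succ {x : ℝ} (hx : 0 < x) :
    stirlingRemainder x - 1 / (12 * x) ≤ stirlingRemainder (x + 1) - 1 / (12 * (x + 1)) := by
  linarith [stirlingRemainder_sub_succ hx, mul_log_one_add_inv_sub_one_le hx]

lemma tendsto_log_factorial_sub :
    Tendsto (fun k : ℕ => log (k.factorial : ℝ) - (k + 1 / 2) * log k + k) atTop
      (𝓝 (log (2 * π) / 2)) := by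
  have h := (continuousAt_log (sqrt_ne_zero'.2 pi_pos)).tendsto.comp
    Stirling.tendsto_stirlingSeq_sqrt_pi
  have h' := h.add_const (log 2 / 2)
  rw [log_sqrt pi_pos.le, ← add_div, add_comm, ← log_mul two_ne_zero pi_ne_zero] at h'
  refine h'.congr' ?_
  filter_upwards [eventually_gt_atTop 0] with k hk
  have hk' : (k : ℝ) ≠ 0 := by exact_mod_cast hk.ne'
  simp only [Function.comp_apply]
  rw [Stirling.log_stirlingSeq_formula, log_mul two_ne_zero hk', log_div hk' (exp_ne_zero _),
    log_exp]
  ring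

lemma tendsto_stirlingRemainder_add_nat {x : ℝ} (hx : 0 < x) :
    Tendsto (fun k : ℕ => stirlingRemainder (x + k)) atTop (𝓝 (log (2 * π) / 2)) := by
  rw [← tendsto_add_atTop_iff_nat 1]
  have h1 : Tendsto (fun k : ℕ => log (Gamma x) - BohrMollerup.logGammaSeq x k) atTop (𝓝 0) := by
    simpa using (BohrMollerup.tendsto_log_gamma hx).const_sub (log (Gamma x))
  have h2 : Tendsto (fun k : ℕ => (k : ℝ) * log (1 + (x + 1) / k)) atTop (𝓝 (x + 1)) :=
    (tendsto_mul_log_one_add_div_atTop (x + 1)).comp tendsto_natCast_atTop_atTop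
  have h3 : Tendsto (fun k : ℕ => log (1 + (x + 1) / k)) atTop (𝓝 0) := by
    have h4 : Tendsto (fun k : ℕ => 1 + (x + 1) / (k : ℝ)) atTop (𝓝 1) := by
      simpa using (tendsto_const_div_atTop_nhds_zero_nat (x + 1)).const_add 1
    simpa [Function.comp_def] using (continuousAt_log one_ne_zero).tendsto.comp h4
  have h := ((h1.add tendsto_log_factorial_sub).sub
    (h2.add (h3.const_mul (x + 1 / 2)))).add_const (x + 1)
  have hlim : 0 + log (2 * π) / 2 - (x + 1 + (x + 1 / 2) * 0) + (x + 1) = log (2 * π) / 2 := by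
    ring
  rw [hlim] at h
  refine h.congr' ?_
  filter_upwards [eventually_gt_atTop 0] with k hk
  have hk' : (0 : ℝ) < k := by exact_mod_cast hk
  have hlog : log (1 + (x + 1) / k) = log (x + (k + 1)) - log k := by
    rw [← log_div (by positivity) hk'.ne']
    congr 1
    field_simp
    ring
  have hG := BohrMollerup.f_add_nat_eq (f := log ∘ Gamma) (fun {y} hy => by
    rw [Function.comp_apply, Gamma_add_one hy.ne', log_mul hy.ne' (Gamma_pos_of_pos hy).ne',
      add_comm, Function.comp_apply]) hx (k + 1)
  simp only [Function.comp_apply] at hG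
  rw [stirlingRemainder, hG, BohrMollerup.logGammaSeq, hlog]
  push_cast
  ring

lemma log_two_pi_le_stirlingRemainder {x : ℝ} (hx : 0 < x) :
    log (2 * π) / 2 ≤ stirlingRemainder x := by
  have hanti : Antitone (fun k : ℕ => stirlingRemainder (x + k)) :=
    antitone_nat_of_succ_le fun k => by
      have := stirlingRemainder_succ_le (x := x + k) (by positivity)
      push_cast
      rwa [add_assoc] at this
  simpa using hanti.le_of_tendsto (tendsto_stirlingRemainder_add_nat hx) 0

lemma stirlingRemainder_le {x : ℝ} (hx : 0 < x) :
    stirlingRemainder x ≤ log (2 * π) / 2 + 1 / (12 * x) := by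
  have hmono : Monotone (fun k : ℕ => stirlingRemainder (x + k) - 1 / (12 * (x + k))) :=
    monotone_nat_of_le_succ fun k => by
      have := stirlingRemainder_sub_inv_le_succ (x := x + k) (by positivity)
      push_cast
      rwa [add_assoc] at this
  have hz : Tendsto (fun k : ℕ => 1 / (12 * (x + k))) atTop (𝓝 0) := by
    simp only [one_div]
    exact ((tendsto_atTop_add_const_left _ x tendsto_natCast_atTop_atTop).const_mul_atTop
      (by norm_num : (0:ℝ) < 12)).inv_tendsto_atTop
  have h := hmono.ge_of_tendsto ((tendsto_stirlingRemainder_add_nat hx).sub hz) 0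
  simp only [Nat.cast_zero, add_zero, sub_zero] at h
  linarith

/-- Upper Stirling-type bound for the logarithm of the beta function. -/
lemma log_beta_le {a b : ℝ} (ha : 0 < a) (hb : 0 < b) :
    log (ProbabilityTheory.beta a b) ≤ log (2 * π) / 2 + 1 / (12 * a) + 1 / (12 * b)
      + (a - 1 / 2) * log a + (b - 1 / 2) * log b - (a + b - 1 / 2) * log (a + b) := by
  have hab : 0 < a + b := by positivity
  have hA := stirlingRemainder_le ha
  have hB := stirlingRemainder_le hb
  have hC := log_two_pi_le_stirlingRemainder hab
  have hGa := (Gamma_pos_of_pos ha).ne'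
  have hGb := (Gamma_pos_of_pos hb).ne'
  rw [ProbabilityTheory.beta, log_div (mul_ne_zero hGa hGb) (Gamma_pos_of_pos hab).ne',
    log_mul hGa hGb]
  rw [stirlingRemainder] at hA hB hC
  linarith

lemma integral_eq_beta {a b : ℝ} (ha : 0 < a) (hb : 0 < b) :
    ∫ x in (0 : ℝ)..1, x ^ (a - 1) * (1 - x) ^ (b - 1) = ProbabilityTheory.beta a b := by
  rw [ProbabilityTheory.beta_eq_betaIntegralReal a b ha hb, Complex.betaIntegral]
  have h : ∫ x in (0 : ℝ)..1, (x : ℂ) ^ ((a : ℂ) - 1) * (1 - (x : ℂ)) ^ ((b : ℂ) - 1)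
      = ∫ x in (0 : ℝ)..1, ((x ^ (a - 1) * (1 - x) ^ (b - 1) : ℝ) : ℂ) := by
    refine intervalIntegral.integral_congr fun x hx => ?_
    rw [Set.uIcc_of_le zero_le_one] at hx
    push_cast
    rw [Complex.ofReal_cpow hx.1, Complex.ofReal_cpow (sub_nonneg.2 hx.2)]
    push_cast
    rfl
  rw [h, intervalIntegral.integral_ofReal, Complex.ofReal_re]

lemma hasDerivAt_rpow_mul_one_sub_rpow {a b x : ℝ} (ha : 1 ≤ a) (hb : 1 ≤ b) (hx0 : 0 ≤ x)
    (hx1 : x ≤ 1) :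
    HasDerivAt (fun y : ℝ => y ^ a * (1 - y) ^ b)
      ((a - (a + b) * x) * (x ^ (a - 1) * (1 - x) ^ (b - 1))) x := by
  have h1 : HasDerivAt (fun y : ℝ => y ^ a) (a * x ^ (a - 1)) x :=
    hasDerivAt_rpow_const (Or.inr ha)
  have h2 : HasDerivAt (fun y : ℝ => (1 - y) ^ b) (-1 * b * (1 - x) ^ (b - 1)) x :=
    ((hasDerivAt_id x).const_sub 1).rpow_const (Or.inr hb)
  have hxa : x ^ a = x ^ (a - 1) * x := by
    rw [← rpow_add_one' hx0 (by linarith), sub_add_cancel]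
  have hxb : (1 - x) ^ b = (1 - x) ^ (b - 1) * (1 - x) := by
    rw [← rpow_add_one' (by linarith) (by linarith), sub_add_cancel]
  refine (h1.mul h2).congr_deriv ?_
  rw [hxa, hxb]
  ring

lemma continuous_beta_weight {a b : ℝ} (ha : 1 ≤ a) (hb : 1 ≤ b) :
    Continuous (fun x : ℝ => x ^ (a - 1) * (1 - x) ^ (b - 1)) :=
  (continuous_id.rpow_const fun _ => Or.inr (by linarith)).mul
    ((continuous_const.sub continuous_id).rpow_const fun _ => Or.inr (by linarith))

/-- Nonnegativity of the second moment of a Beta variable about `a / (a + b) + c`, restricted to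
the tail `[z, 1]`, with the tail moments evaluated through integration by parts. -/
lemma beta_tail_second_moment {a b z : ℝ} (ha : 1 ≤ a) (hb : 1 ≤ b) (hz0 : 0 ≤ z) (hz1 : z ≤ 1)
    (c : ℝ) :
    z ^ a * (1 - z) ^ b / (a + b)
        * (2 * c - (1 - 2 * (a / (a + b)) + (a + b) * (z - a / (a + b))) / (a + b + 1))
      ≤ (c ^ 2 + a * b / ((a + b) ^ 2 * (a + b + 1)))
        * ∫ x in z..1, x ^ (a - 1) * (1 - x) ^ (b - 1) := by
  set n := a + b with hn
  have hn0 : 0 < n := by linarith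
  have hw := continuous_beta_weight ha hb
  set w : ℝ → ℝ := fun x => x ^ (a - 1) * (1 - x) ^ (b - 1) with hwdef
  set A := c ^ 2 + a * b / (n ^ 2 * (n + 1)) with hA
  let P : ℝ → ℝ := fun x =>
    (2 * c - (1 - 2 * (a / n)) / (n + 1)) / n - (x - a / n) / (n + 1)
  have hderiv : ∀ x ∈ Set.uIcc z 1, HasDerivAt (fun y => P y * (y ^ a * (1 - y) ^ b))
      ((c - (x - a / n)) ^ 2 * w x - A * w x) x := by
    intro x hx
    rw [Set.uIcc_of_le hz1] at hx
    have hP : HasDerivAt P (-(1 / (n + 1))) x :=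
      (((hasDerivAt_id x).sub_const (a / n)).div_const (n + 1)).const_sub _
    have hx0 : 0 ≤ x := hz0.trans hx.1
    have hxa : x ^ a = x ^ (a - 1) * x := by
      rw [← rpow_add_one' hx0 (by linarith), sub_add_cancel]
    have hxb : (1 - x) ^ b = (1 - x) ^ (b - 1) * (1 - x) := by
      rw [← rpow_add_one' (by linarith [hx.2]) (by linarith), sub_add_cancel]
    refine (hP.mul (hasDerivAt_rpow_mul_one_sub_rpow ha hb hx0 hx.2)).congr_deriv ?_
    have hb' : b = n - a := by rw [hn]; ring
    simp only [P, hA, hwdef]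
    rw [hxa, hxb, ← hn]
    generalize x ^ (a - 1) = u
    generalize (1 - x) ^ (b - 1) = v
    rw [hb']
    field_simp
    ring
  have hint : ∀ g : ℝ → ℝ, Continuous g → IntervalIntegrable g MeasureTheory.volume z 1 :=
    fun g hg => hg.intervalIntegrable z 1
  have hc1 : Continuous fun x => (c - (x - a / n)) ^ 2 * w x := by fun_prop
  have hc2 : Continuous fun x => A * w x := by fun_prop
  have hftc := intervalIntegral.integral_eq_sub_of_hasDerivAt hderiv
    (hint _ (hc1.sub hc2))
  rw [intervalIntegral.integral_sub (hint _ hc1) (hint _ hc2),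
    intervalIntegral.integral_const_mul, sub_self, zero_rpow (by linarith)] at hftc
  have hnonneg : 0 ≤ ∫ x in z..1, (c - (x - a / n)) ^ 2 * w x :=
    intervalIntegral.integral_nonneg hz1 fun x hx =>
      mul_nonneg (sq_nonneg _) (mul_nonneg (rpow_nonneg (hz0.trans hx.1) _)
        (rpow_nonneg (sub_nonneg.2 hx.2) _))
  have hPz : P z * (z ^ a * (1 - z) ^ b) = z ^ a * (1 - z) ^ b / n
      * (2 * c - (1 - 2 * (a / n) + n * (z - a / n)) / (n + 1)) := by
    simp only [P]
    field_simp
    ring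
  linarith

lemma sub_sq_half_le_log_one_add {u : ℝ} (hu : 0 ≤ u) : u - u ^ 2 / 2 ≤ log (1 + u) := by
  refine le_trans ?_ (le_log_one_add_of_nonneg hu)
  rw [le_div_iff₀ (by linarith)]
  nlinarith [pow_nonneg hu 3]

lemma neg_sub_le_log_one_sub {v : ℝ} (hv0 : 0 ≤ v) (hv1 : v < 1) :
    -v - v ^ 2 / (2 * (1 - v)) ≤ log (1 - v) := by
  have h1 : 0 < 1 - v := by linarith
  have h := self_le_sinh_iff.2 (neg_nonneg.2 (log_nonpos h1.le (by linarith)))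
  rw [sinh_eq, neg_neg, exp_neg, exp_log h1] at h
  have h2 : ((1 - v)⁻¹ - (1 - v)) / 2 = v + v ^ 2 / (2 * (1 - v)) := by
    field_simp
    ring
  linarith

/-- Lower bound for `x ↦ x ^ a (1 - x) ^ b` near its maximum, on the logarithmic scale. -/
lemma neg_le_mul_log_add_mul_log {a b D K : ℝ} (ha : 0 < a) (hD : 0 ≤ D) (hDb : D < b)
    (hK : D ^ 2 * (a + b) ≤ 2 * K * (a * (b - D))) :
    a * log a + b * log b - K ≤ a * log (a + D) + b * log (b - D) := by
  have hb : 0 < b := by linarith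
  have hbD : 0 < b - D := by linarith
  have h1 := sub_sq_half_le_log_one_add (u := D / a) (by positivity)
  have h2 := neg_sub_le_log_one_sub (v := D / b) (by positivity) ((div_lt_one hb).2 hDb)
  have e1 : 1 + D / a = (a + D) / a := by field_simp
  have e2 : 1 - D / b = (b - D) / b := by field_simp
  rw [e1, log_div (by positivity) ha.ne'] at h1
  rw [e2, log_div hbD.ne' hb.ne'] at h2
  have h1' := mul_le_mul_of_nonneg_left h1 ha.le
  have h2' := mul_le_mul_of_nonneg_left h2 hb.le
  have e3 : a * (D / a - (D / a) ^ 2 / 2) + b * (-(D / b) - (D / b) ^ 2 / (2 * ((b - D) / b)))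
      = -(D ^ 2 * (a + b - D) / (2 * (a * (b - D)))) := by
    field_simp
    ring
  have h3 : D ^ 2 * (a + b - D) / (2 * (a * (b - D))) ≤ K := by
    rw [div_le_iff₀ (by positivity)]
    nlinarith [pow_nonneg hD 3]
  linarith

lemma sq_mul_le_of_le_half {a b D ρ : ℝ} (ha : 6 ≤ a) (hb : 6 ≤ b)
    (hρ2 : ρ ^ 2 * (a + b + 1) = a * b) (hD : 0 ≤ D) (hDρ : D ≤ (ρ + 1) / 2) :
    D ^ 2 * (a + b) ≤ 2 * 0.41 * (a * (b - D)) := by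
  have hn : 0 < a + b := by linarith
  set r := √(a * b / (a + b)) with hr
  have hr2 : r ^ 2 = a * b / (a + b) := sq_sqrt (by positivity)
  have hr0 : 0 ≤ r := sqrt_nonneg _
  have hr2' : r ^ 2 * (a + b) = a * b := by rw [hr2]; field_simp
  set q := 2 * a / (a + b) with hq
  have hq' : q * (a + b) = 2 * a := by rw [hq]; field_simp
  have hq0 : 0 ≤ q := by positivity
  have hq2 : q ≤ 2 := by
    rw [hq, div_le_iff₀ hn]
    linarith
  have hqr : 3 * q ≤ r ^ 2 := by
    rw [hq, hr2, ← mul_div_assoc]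
    refine div_le_div_of_nonneg_right ?_ hn.le
    nlinarith
  have hr3 : 3 ≤ r ^ 2 := by
    rw [hr2, le_div_iff₀ hn]
    nlinarith
  have hρr : ρ ≤ r := by
    apply le_sqrt_of_sq_le
    rw [le_div_iff₀ hn]
    nlinarith [sq_nonneg ρ]
  have hDr : D ≤ (r + 1) / 2 := by linarith
  have hr1 : 1.73 ≤ r := by nlinarith
  have hkey : (r + 1) ^ 2 / 4 + 0.205 * q * (r + 1) ≤ 0.82 * r ^ 2 := by
    rcases le_total r 2.45 with h | h
    · have : q * (r + 1) ≤ r ^ 2 / 3 * (r + 1) := by gcongr; linarith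
      nlinarith [mul_nonneg (mul_nonneg hr0 hr0) (sub_nonneg.2 h),
        mul_nonneg (sub_nonneg.2 h) (sub_nonneg.2 hr1)]
    · have : q * (r + 1) ≤ 2 * (r + 1) := by gcongr
      nlinarith
  have h1 : D ^ 2 ≤ ((r + 1) / 2) ^ 2 := by gcongr
  have h2 : q * D ≤ q * ((r + 1) / 2) := by gcongr
  have h3 : D ^ 2 + 0.41 * (q * D) ≤ 0.82 * r ^ 2 := by nlinarith
  have h4 := mul_le_mul_of_nonneg_right h3 hn.le
  have h5 : q * D * (a + b) = 2 * a * D := by rw [← hq']; ring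
  nlinarith

lemma sub_add_mul_le {a b D ρ : ℝ} (ha : 6 ≤ a) (hb : 6 ≤ b) (hρ : 0 ≤ ρ)
    (hρ2 : ρ ^ 2 * (a + b + 1) = a * b) (hDρ : D ≤ (ρ + 1) / 2) :
    b - a + (a + b) * D ≤ 1.12 * ρ * (a + b + 1) := by
  have hn : 0 < a + b := by linarith
  have h1 : (a + b) * D ≤ (a + b) * ((ρ + 1) / 2) := by gcongr
  have h2 : (3 * b - a) / 2 ≤ 0.62 * (ρ * (a + b + 1)) := by
    rcases le_total (3 * b - a) 0 with h | h
    · have : 0 ≤ ρ * (a + b + 1) := by positivity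
      linarith
    · apply le_of_sq_le_sq ?_ (by positivity)
      have e : (0.62 * (ρ * (a + b + 1))) ^ 2 = 0.3844 * (a * b * (a + b + 1)) := by
        rw [← hρ2]; ring
      rw [e]
      have : 6 * (b * (a + b)) ≤ a * (b * (a + b)) := by gcongr
      nlinarith [mul_nonneg (by linarith : 0 ≤ a) h,
        mul_nonneg (by linarith : 0 ≤ a) (by linarith : 0 ≤ b), sq_nonneg b]
  nlinarith

lemma const_le_exp_neg : 0.256 ≤ exp (-(0.438 + log (2 * π) / 2)) := by
  have h1 : exp (0.876 : ℝ) ≤ 2.402 := by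
    refine (exp_bound' (x := 0.876) (by norm_num) (by norm_num) (n := 8) (by norm_num)).trans ?_
    norm_num [Finset.sum_range_succ, Nat.factorial]
  have h2 : exp (-(0.438 + log (2 * π) / 2)) ^ 2 * (exp 0.876 * (2 * π)) = 1 := by
    nth_rewrite 2 [← exp_log (show 0 < 2 * π by positivity)]
    rw [← exp_nat_mul, ← exp_add, ← exp_add, exp_eq_one_iff]
    push_cast
    ring
  have h3 : exp (0.876 : ℝ) * (2 * π) ≤ 2.402 * (2 * 3.1416) := by
    gcongr
    exact pi_lt_d4.le
  have h4 := exp_pos (-(0.438 + log (2 * π) / 2))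
  by_contra! h5
  have h6 : exp (-(0.438 + log (2 * π) / 2)) ^ 2 ≤ 0.256 ^ 2 := by gcongr
  have h7 := mul_le_mul h6 h3 (by positivity) (by norm_num)
  rw [h2] at h7
  norm_num at h7

/-- Lower bound for the Beta weight just above the mean, in terms of the Beta function. -/
lemma mul_beta_le_rpow_mul_rpow {a b D ρ : ℝ} (ha : 6 ≤ a) (hb : 6 ≤ b) (hρ : 0 < ρ)
    (hρ2 : ρ ^ 2 * (a + b + 1) = a * b) (hD : 0 ≤ D) (hDρ : D ≤ (ρ + 1) / 2) (hDb : D < b) :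
    0.256 * (ρ * ProbabilityTheory.beta a b)
      ≤ ((a + D) / (a + b)) ^ a * ((b - D) / (a + b)) ^ b := by
  have ha0 : 0 < a := by linarith
  have hb0 : 0 < b := by linarith
  have hn : 0 < a + b := by linarith
  have haD : 0 < a + D := by linarith
  have hbD : 0 < b - D := by linarith
  have hβ := ProbabilityTheory.beta_pos ha0 hb0
  have hB := log_beta_le ha0 hb0
  have hL := neg_le_mul_log_add_mul_log ha0 hD hDb (sq_mul_le_of_le_half ha hb hρ2 hD hDρ)
  have hlogρ := congrArg log hρ2
  rw [log_mul (by positivity) (by positivity), log_mul ha0.ne' hb0.ne', log_pow] at hlogρ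
  have hmono : log (a + b) ≤ log (a + b + 1) := log_le_log hn (by linarith)
  have hinv : ∀ x : ℝ, 6 ≤ x → 1 / (12 * x) ≤ 1 / 72 := fun x hx =>
    one_div_le_one_div_of_le (by norm_num) (by linarith)
  have hia := hinv a ha
  have hib := hinv b hb
  refine (mul_le_mul_of_nonneg_right const_le_exp_neg (by positivity)).trans ?_
  rw [← log_le_log_iff (by positivity) (by positivity), log_mul (exp_ne_zero _) (by positivity),
    log_exp, log_mul hρ.ne' hβ.ne',
    log_mul (rpow_pos_of_pos (by positivity) _).ne' (rpow_pos_of_pos (by positivity) _).ne',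
    log_rpow (by positivity), log_rpow (by positivity), log_div haD.ne' hn.ne', log_div hbD.ne' hn.ne']
  push_cast at hlogρ
  linarith

/-- Anti-concentration for Beta random variables (Lemma on Beta anti-concentration). -/
theorem stmt_2 (a b : ℝ) (ha : 6 ≤ a) (hb : 6 ≤ b) (C : ℝ) (hC0 : 0 < C) (hC : C ≤ 1 / 2) :
    0.15 ≤ 1 - betaCDF a b
      (a / (a + b) + C * Real.sqrt (a * b / ((a + b) ^ 2 * (a + b + 1))) + C / (a + b)) := by
  have ha0 : 0 < a := by linarith
  have hb0 : 0 < b := by linarith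
  have hn : 0 < a + b := by linarith
  set ρ := √(a * b / (a + b + 1)) with hρdef
  have hρ : 0 < ρ := sqrt_pos.2 (by positivity)
  have hρsq : ρ ^ 2 = a * b / (a + b + 1) := sq_sqrt (by positivity)
  have hρ2 : ρ ^ 2 * (a + b + 1) = a * b := by
    rw [hρsq]
    field_simp
  have hσ : √(a * b / ((a + b) ^ 2 * (a + b + 1))) = ρ / (a + b) := by
    rw [hρdef, mul_comm ((a + b) ^ 2), ← div_div, sqrt_div' _ (sq_nonneg _), sqrt_sq hn.le]
  set D := C * (ρ + 1) with hDdef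
  have hD : 0 ≤ D := by positivity
  have hDρ : D ≤ (ρ + 1) / 2 := by
    rw [hDdef]
    nlinarith
  have hρb : ρ < b := by
    have : ρ ^ 2 < b ^ 2 := by
      rw [hρsq, div_lt_iff₀ (by positivity)]
      nlinarith [mul_pos ha0 hb0, pow_pos hb0 3, mul_nonneg (mul_pos ha0 hb0).le (sub_nonneg.2 hb)]
    exact lt_of_pow_lt_pow_left₀ 2 hb0.le this
  have hDb : D < b := by linarith
  have hz : a / (a + b) + C * √(a * b / ((a + b) ^ 2 * (a + b + 1))) + C / (a + b)
      = (a + D) / (a + b) := by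
    rw [hσ, hDdef]
    ring
  rw [hz]
  set z := (a + D) / (a + b) with hzdef
  have hz0 : 0 ≤ z := by positivity
  have hz1' : 1 - z = (b - D) / (a + b) := by
    rw [hzdef]
    field_simp
    ring
  have hz1 : z ≤ 1 := by
    have : 0 ≤ (b - D) / (a + b) := div_nonneg (by linarith) hn.le
    linarith
  have hβ := ProbabilityTheory.beta_pos ha0 hb0
  have hW := mul_beta_le_rpow_mul_rpow ha hb hρ hρ2 hD hDρ hDb
  rw [← hzdef, ← hz1'] at hW
  have hT := beta_tail_second_moment (a := a) (b := b) (by linarith) (by linarith) hz0 hz1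
    (1.7 * (ρ / (a + b)))
  have hcont := continuous_beta_weight (a := a) (b := b) (by linarith) (by linarith)
  have hsplit := intervalIntegral.integral_add_adjacent_intervals
    (hcont.intervalIntegrable (μ := MeasureTheory.volume) 0 z) (hcont.intervalIntegrable z 1)
  rw [integral_eq_beta ha0 hb0] at hsplit
  rw [betaCDF, integral_eq_beta ha0 hb0, one_sub_div hβ.ne', le_div_iff₀ hβ]
  set T := ∫ x in z..1, x ^ (a - 1) * (1 - x) ^ (b - 1) with hTdef
  set W := z ^ a * (1 - z) ^ b with hWdef
  have hW0 : 0 ≤ W := le_trans (by positivity) hW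
  have hvar : (1.7 * (ρ / (a + b))) ^ 2 + a * b / ((a + b) ^ 2 * (a + b + 1))
      = 3.89 * (ρ / (a + b)) ^ 2 := by
    have : a * b / ((a + b) ^ 2 * (a + b + 1)) = (ρ / (a + b)) ^ 2 := by
      rw [div_pow, hρsq, div_div, mul_comm ((a + b) ^ 2)]
    rw [this]
    ring
  have hτ : (1 - 2 * (a / (a + b)) + (a + b) * (z - a / (a + b))) / (a + b + 1)
      ≤ 1.12 * (ρ / (a + b)) := by
    have h := sub_add_mul_le ha hb hρ.le hρ2 hDρ
    have e : 1 - 2 * (a / (a + b)) + (a + b) * (z - a / (a + b))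
        = (b - a + (a + b) * D) / (a + b) := by
      rw [hzdef]
      field_simp
      ring
    rw [e, div_div, ← mul_div_assoc, div_le_div_iff₀ (by positivity) hn]
    nlinarith
  rw [hvar] at hT
  have hT2 : W / (a + b) * (2.28 * (ρ / (a + b))) ≤ 3.89 * (ρ / (a + b)) ^ 2 * T := by
    refine le_trans ?_ hT
    gcongr
    linarith
  have hT3 : 2.28 * W ≤ 3.89 * (ρ * T) := by
    have e1 : W / (a + b) * (2.28 * (ρ / (a + b))) = 2.28 * W * (ρ / (a + b) ^ 2) := by
      field_simp
    have e2 : 3.89 * (ρ / (a + b)) ^ 2 * T = 3.89 * (ρ * T) * (ρ / (a + b) ^ 2) := by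
      field_simp
    rw [e1, e2] at hT2
    exact le_of_mul_le_mul_right hT2 (by positivity)
  have hfin : 0.15 * ProbabilityTheory.beta a b ≤ T := by
    refine le_of_mul_le_mul_left (a := ρ) ?_ hρ
    have : 0 ≤ ρ * ProbabilityTheory.beta a b := by positivity
    linarith
  linarith
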